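/- For a differentiable family of positive definite density matrices ρ_t on [0,T] in dimension d, T ≥ |I(ρ_T) − I(ρ_0)| / (Λ · L), where I(ρ) = ln d − S(ρ), Λ = sqrt((1/T)∫₀ᵀ ‖ρ̇_t‖²_tr dt) and L = sqrt((1/T)∫₀ᵀ ‖ln ρ_t‖²_op dt), assuming Λ·L > 0. -/

import Mathlib

noncomputable section

open Matrix MeasureTheory
open scoped ComplexOrder

def matLog {n : Type*} [Fintype n] [DecidableEq n] (A : Matrix n n ℂ) : Matrix n n ℂ :=
  cfc Real.log A

def hsNorm {n : Type*} [Fintype n] (A : Matrix n n ℂ) : ℝ :=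
  Real.sqrt (Matrix.trace (Aᴴ * A)).re

def trNorm {n : Type*} [Fintype n] [DecidableEq n] (A : Matrix n n ℂ) : ℝ :=
  (Matrix.trace (cfc Real.sqrt (Aᴴ * A))).re

def opNorm {n : Type*} [Fintype n] [DecidableEq n] {A : Matrix n n ℂ}
    (hA : A.IsHermitian) : ℝ :=
  ⨆ i, |hA.eigenvalues i|

def vnEntropy {n : Type*} [Fintype n] [DecidableEq n] (ρ : Matrix n n ℂ) : ℝ :=
  -(Matrix.trace (ρ * matLog ρ)).re

def maxInfo {n : Type*} [Fintype n] [DecidableEq n] (ρ : Matrix n n ℂ) : ℝ :=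
  Real.log (Fintype.card n) - vnEntropy ρ

def deph {n : Type*} [DecidableEq n] (A : Matrix n n ℂ) : Matrix n n ℂ :=
  Matrix.diagonal (fun i => A i i)

def relEntCoh {n : Type*} [Fintype n] [DecidableEq n] (ρ : Matrix n n ℂ) : ℝ :=
  vnEntropy (deph ρ) - vnEntropy ρ

open scoped Topology

namespace Matrix

lemma isHermitian_of_hasDerivAt {n : Type*} {ρ : ℝ → Matrix n n ℂ} {ρ' : Matrix n n ℂ}
    {t : ℝ} (hρ : ∀ t, (ρ t).IsHermitian) (hd : ∀ i j, HasDerivAt (fun s => ρ s i j) (ρ' i j) t) :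
    ρ'.IsHermitian := by
  refine IsHermitian.ext fun i j => ((hd j i).star.congr_of_eventuallyEq ?_).unique (hd i j)
  exact Filter.Eventually.of_forall fun s => ((hρ s).apply i j).symm

variable {n : Type*} [Fintype n] [DecidableEq n] {A B : Matrix n n ℂ}

/-- The transition weights `|⟨uᵢ, vⱼ⟩|²` between two orthonormal eigenbases express
traces of products of functions of the two matrices. -/
lemma IsHermitian.exists_trace_cfc_mul_cfc (hA : A.IsHermitian) (hB : B.IsHermitian) :
    ∃ P : n → n → ℝ, (∀ i j, 0 ≤ P i j) ∧ ∀ f g : ℝ → ℝ,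
      (trace (cfc f A * cfc g B)).re
        = ∑ i, ∑ j, f (hA.eigenvalues i) * g (hB.eigenvalues j) * P i j := by
  set W : unitaryGroup n ℂ := star hA.eigenvectorUnitary * hB.eigenvectorUnitary with hW
  refine ⟨fun i j => Complex.normSq ((W : Matrix n n ℂ) i j), fun i j => Complex.normSq_nonneg _,
    fun f g => ?_⟩
  rw [hA.cfc_eq, hB.cfc_eq, IsHermitian.cfc, IsHermitian.cfc, Unitary.conjStarAlgAut_apply,
    Unitary.conjStarAlgAut_apply]
  have hWc : (W : Matrix n n ℂ)
      = star (hA.eigenvectorUnitary : Matrix n n ℂ) * (hB.eigenvectorUnitary : Matrix n n ℂ) := by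
    simp [hW]
  set U := (hA.eigenvectorUnitary : Matrix n n ℂ)
  set V := (hB.eigenvectorUnitary : Matrix n n ℂ)
  set D : Matrix n n ℂ := diagonal (RCLike.ofReal ∘ f ∘ hA.eigenvalues)
  set E : Matrix n n ℂ := diagonal (RCLike.ofReal ∘ g ∘ hB.eigenvalues)
  have h : trace (U * D * star U * (V * E * star V))
      = trace (D * (W : Matrix n n ℂ) * (E * star (W : Matrix n n ℂ))) := by
    rw [hWc, star_mul, star_star]
    simp only [Matrix.mul_assoc]
    rw [trace_mul_comm]
    simp only [Matrix.mul_assoc]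
  rw [h, trace, Complex.re_sum]
  refine Finset.sum_congr rfl fun i _ => ?_
  rw [diag_apply, mul_apply, Complex.re_sum]
  refine Finset.sum_congr rfl fun j _ => ?_
  simp only [D, E, diagonal_mul, star_apply, Function.comp_apply]
  have : ((f (hA.eigenvalues i) : ℂ) * (W : Matrix n n ℂ) i j) *
      ((g (hB.eigenvalues j) : ℂ) * star ((W : Matrix n n ℂ) i j))
      = ((f (hA.eigenvalues i) * g (hB.eigenvalues j)
        * Complex.normSq ((W : Matrix n n ℂ) i j) : ℝ) : ℂ) := by
    push_cast
    rw [← Complex.mul_conj]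
    simp only [RCLike.star_def]
    ring
  exact (congrArg Complex.re this).trans (Complex.ofReal_re _)

lemma continuousOn_spectrum_real (A : Matrix n n ℂ) (f : ℝ → ℝ) :
    ContinuousOn f (spectrum ℝ A) :=
  (finite_real_spectrum (A := A)).continuousOn f

/-- Klein's inequality: the relative entropy of two positive definite matrices of equal trace is
nonnegative. -/
lemma PosDef.trace_mul_matLog_le (hA : A.PosDef) (hB : B.PosDef) (htr : A.trace = B.trace) :
    (trace (A * matLog B)).re ≤ (trace (A * matLog A)).re := by
  obtain ⟨P, hP, h⟩ := hA.isHermitian.exists_trace_cfc_mul_cfc hB.isHermitian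
  have hAA : A * matLog A = cfc (fun x => x * Real.log x) A * cfc (fun _ => (1 : ℝ)) B := by
    rw [cfc_const_one ℝ B hB.isHermitian.isSelfAdjoint,
      cfc_mul (fun x => x) Real.log A (continuousOn_spectrum_real _ _)
      (continuousOn_spectrum_real _ _), cfc_id' ℝ A hA.isHermitian.isSelfAdjoint, mul_one, matLog]
  have hAB : A * matLog B = cfc (fun x : ℝ => x) A * cfc Real.log B := by
    rw [cfc_id' ℝ A hA.isHermitian.isSelfAdjoint, matLog]
  have hA1 : A = cfc (fun x : ℝ => x) A * cfc (fun _ => (1 : ℝ)) B := by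
    rw [cfc_id' ℝ A hA.isHermitian.isSelfAdjoint,
      cfc_const_one ℝ B hB.isHermitian.isSelfAdjoint, mul_one]
  have hB1 : B = cfc (fun _ => (1 : ℝ)) A * cfc (fun x : ℝ => x) B := by
    rw [cfc_id' ℝ B hB.isHermitian.isSelfAdjoint,
      cfc_const_one ℝ A hA.isHermitian.isSelfAdjoint, one_mul]
  have htr' : (trace (cfc (fun x : ℝ => x) A * cfc (fun _ => (1 : ℝ)) B)).re
      = (trace (cfc (fun _ => (1 : ℝ)) A * cfc (fun x : ℝ => x) B)).re := by
    rw [← hA1, ← hB1, htr]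
  rw [hAA, hAB, h, h]
  rw [h, h] at htr'
  have key : ∀ i j, 0 ≤ (hA.isHermitian.eigenvalues i * Real.log (hA.isHermitian.eigenvalues i)
      - hA.isHermitian.eigenvalues i * Real.log (hB.isHermitian.eigenvalues j)
      - hA.isHermitian.eigenvalues i + hB.isHermitian.eigenvalues j) * P i j := by
    intro i j
    refine mul_nonneg ?_ (hP i j)
    have ha := hA.eigenvalues_pos i
    have hb := hB.eigenvalues_pos j
    have hlog := Real.log_le_sub_one_of_pos (div_pos hb ha)
    rw [Real.log_div hb.ne' ha.ne'] at hlog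
    have := mul_le_mul_of_nonneg_left hlog ha.le
    rw [mul_sub, mul_sub, mul_div_cancel₀ _ ha.ne'] at this
    linarith
  have hsum := Finset.sum_nonneg fun i (_ : i ∈ Finset.univ) =>
    Finset.sum_nonneg fun j (_ : j ∈ Finset.univ) => key i j
  simp only [add_mul, sub_mul, Finset.sum_add_distrib, Finset.sum_sub_distrib, one_mul, mul_one]
    at hsum htr' ⊢
  linarith

lemma trNorm_eq_trace_cfc_abs (hA : A.IsHermitian) :
    trNorm A = (trace (cfc (fun x : ℝ => |x|) A)).re := by
  rw [trNorm, hA.eq]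
  have h : A * A = cfc (fun x : ℝ => x ^ 2) A := by
    rw [cfc_pow_id (R := ℝ) A 2 hA.isSelfAdjoint, pow_two]
  rw [h, ← cfc_comp' Real.sqrt (fun x : ℝ => x ^ 2) A
    Real.continuous_sqrt.continuousOn (continuousOn_spectrum_real _ _) hA.isSelfAdjoint]
  simp only [Real.sqrt_sq_eq_abs]

lemma opNorm_nonneg (hA : A.IsHermitian) : 0 ≤ opNorm hA :=
  Real.iSup_nonneg fun _ => abs_nonneg _

lemma trNorm_nonneg (hA : A.IsHermitian) : 0 ≤ trNorm A := by
  obtain ⟨P, hP, h⟩ := hA.exists_trace_cfc_mul_cfc hA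
  have h1 := h (fun x => |x|) fun _ => 1
  rw [cfc_const_one ℝ A hA.isSelfAdjoint, mul_one, ← trNorm_eq_trace_cfc_abs hA] at h1
  rw [h1]
  exact Finset.sum_nonneg fun i _ => Finset.sum_nonneg fun j _ => by have := hP i j; positivity

/-- Trace-norm/operator-norm duality for Hermitian matrices. -/
lemma abs_trace_mul_le (hA : A.IsHermitian) (hB : B.IsHermitian) :
    |(trace (A * B)).re| ≤ trNorm A * opNorm hB := by
  obtain ⟨P, hP, h⟩ := hA.exists_trace_cfc_mul_cfc hB
  have h1 := h (fun x => |x|) fun _ => 1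
  rw [cfc_const_one ℝ B hB.isSelfAdjoint, mul_one, ← trNorm_eq_trace_cfc_abs hA] at h1
  have h2 := h (fun x => x) fun x => x
  rw [cfc_id' ℝ A hA.isSelfAdjoint, cfc_id' ℝ B hB.isSelfAdjoint] at h2
  rw [h1, h2, Finset.sum_mul]
  refine (Finset.abs_sum_le_sum_abs _ _).trans (Finset.sum_le_sum fun i _ => ?_)
  rw [Finset.sum_mul]
  refine (Finset.abs_sum_le_sum_abs _ _).trans (Finset.sum_le_sum fun j _ => ?_)
  have hj : |hB.eigenvalues j| ≤ opNorm hB :=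
    le_ciSup (f := fun j => |hB.eigenvalues j|) (Set.finite_range _).bddAbove j
  rw [abs_mul, abs_mul, abs_of_nonneg (hP i j), mul_one, mul_right_comm]
  exact mul_le_mul_of_nonneg_left hj (mul_nonneg (abs_nonneg _) (hP i j))

open scoped Matrix.Norms.L2Operator in
lemma continuous_matLog_comp {X : Type*} [TopologicalSpace X] {ρ : X → Matrix n n ℂ}
    (hρ : Continuous ρ) (hpd : ∀ t, (ρ t).PosDef) : Continuous fun t => matLog (ρ t) :=
  (CFC.continuousOn_log (A := Matrix n n ℂ)).comp_continuous hρ fun t =>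
    ⟨(hpd t).isHermitian.isSelfAdjoint, (hpd t).isUnit⟩

lemma hasDerivAt_re_trace_mul_matLog {ρ : ℝ → Matrix n n ℂ} {ρ' : Matrix n n ℂ} {t : ℝ}
    (hpd : ∀ t, (ρ t).PosDef) (htr : ∀ s t, (ρ s).trace = (ρ t).trace) (hρ : Continuous ρ)
    (hd : ∀ i j, HasDerivAt (fun s => ρ s i j) (ρ' i j) t) :
    HasDerivAt (fun s => (trace (ρ s * matLog (ρ s))).re) (trace (ρ' * matLog (ρ t))).re t := by
  rw [hasDerivAt_iff_tendsto_slope]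
  have hslope : Filter.Tendsto (fun s => (s - t)⁻¹ • (ρ s - ρ t)) (𝓝[≠] t) (𝓝 ρ') := by
    refine tendsto_pi_nhds.2 fun i => tendsto_pi_nhds.2 fun j => ?_
    exact hasDerivAt_iff_tendsto_slope.1 (hd i j)
  have hlog := continuous_matLog_comp hρ hpd
  have hcont : Continuous fun p : Matrix n n ℂ × Matrix n n ℂ => (trace (p.1 * p.2)).re :=
    Complex.continuous_re.comp (continuous_fst.matrix_mul continuous_snd).matrix_trace
  have h1 := (hcont.tendsto (ρ', matLog (ρ t))).comp
    (hslope.prodMk_nhds (tendsto_const_nhds (x := matLog (ρ t))))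
  have h2 := (hcont.tendsto (ρ', matLog (ρ t))).comp
    (hslope.prodMk_nhds ((hlog.tendsto t).mono_left nhdsWithin_le_nhds))
  have hmin := h1.min h2
  have hmax := h1.max h2
  rw [min_self] at hmin
  rw [max_self] at hmax
  have key : ∀ s, slope (fun s => (trace (ρ s * matLog (ρ s))).re) t s ∈
      Set.uIcc (trace ((s - t)⁻¹ • (ρ s - ρ t) * matLog (ρ t))).re
        (trace ((s - t)⁻¹ • (ρ s - ρ t) * matLog (ρ s))).re := by
    intro s
    have k1 := (hpd s).trace_mul_matLog_le (hpd t) (htr s t)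
    have k2 := (hpd t).trace_mul_matLog_le (hpd s) (htr t s)
    simp only [slope_def_module, smul_mul_assoc, trace_smul, Complex.smul_re, smul_eq_mul,
      sub_mul, trace_sub, Complex.sub_re]
    rcases le_total 0 (s - t)⁻¹ with h | h
    · exact Set.Icc_subset_uIcc ⟨mul_le_mul_of_nonneg_left (by linarith) h,
        mul_le_mul_of_nonneg_left (by linarith) h⟩
    · exact Set.Icc_subset_uIcc' ⟨mul_le_mul_of_nonpos_left (by linarith) h,
        mul_le_mul_of_nonpos_left (by linarith) h⟩
  exact tendsto_of_tendsto_of_tendsto_of_le_of_le hmin hmax (fun s => (key s).1)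
    fun s => (key s).2

end Matrix

/-- Cauchy–Schwarz for interval integrals of nonnegative functions with integrable squares. -/
lemma intervalIntegral_mul_le_sqrt_mul_sqrt {f g : ℝ → ℝ} {a b : ℝ} (hab : a ≤ b)
    (hf0 : ∀ t, 0 ≤ f t) (hg0 : ∀ t, 0 ≤ g t)
    (hf : IntervalIntegrable (fun t => f t ^ 2) volume a b)
    (hg : IntervalIntegrable (fun t => g t ^ 2) volume a b) :
    IntervalIntegrable (fun t => f t * g t) volume a b ∧
      ∫ t in a..b, f t * g t ≤ √(∫ t in a..b, f t ^ 2) * √(∫ t in a..b, g t ^ 2) := by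
  have memLp {h : ℝ → ℝ} (h0 : ∀ t, 0 ≤ h t)
      (hh : IntervalIntegrable (fun t => h t ^ 2) volume a b) :
      MemLp h 2 (volume.restrict (Set.Ioc a b)) := by
    have hi := (intervalIntegrable_iff_integrableOn_Ioc_of_le hab).1 hh
    have hm : AEStronglyMeasurable h (volume.restrict (Set.Ioc a b)) :=
      (Real.continuous_sqrt.comp_aestronglyMeasurable hi.aestronglyMeasurable).congr
        (Filter.Eventually.of_forall fun t => Real.sqrt_sq (h0 t))
    exact (memLp_two_iff_integrable_sq hm).2 hi
  refine ⟨(intervalIntegrable_iff_integrableOn_Ioc_of_le hab).2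
    ((memLp hf0 hf).integrable_mul (memLp hg0 hg)), ?_⟩
  simp only [intervalIntegral.integral_of_le hab]
  have := integral_mul_le_Lp_mul_Lq_of_nonneg Real.HolderConjugate.two_two
    (Filter.Eventually.of_forall hf0) (Filter.Eventually.of_forall hg0)
    (by simpa using memLp hf0 hf) (by simpa using memLp hg0 hg)
  simpa [Real.sqrt_eq_rpow] using this

theorem info_speed_limit {n : Type*} [Fintype n] [DecidableEq n]
    (ρ ρ' : ℝ → Matrix n n ℂ) (T : ℝ) (hT : 0 < T)
    (hpd : ∀ t, (ρ t).PosDef) (htr : ∀ t, (ρ t).trace = 1)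
    (hd : ∀ t i j, HasDerivAt (fun s => ρ s i j) (ρ' t i j) t)
    (hc : ∀ i j, Continuous fun t => ρ' t i j)
    (hL : ∀ t, (matLog (ρ t)).IsHermitian)
    (hpos : 0 < Real.sqrt ((1 / T) * ∫ t in (0:ℝ)..T, (trNorm (ρ' t)) ^ 2) *
        Real.sqrt ((1 / T) * ∫ t in (0:ℝ)..T, (opNorm (hL t)) ^ 2)) :
    |maxInfo (ρ T) - maxInfo (ρ 0)| /
      (Real.sqrt ((1 / T) * ∫ t in (0:ℝ)..T, (trNorm (ρ' t)) ^ 2) *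
        Real.sqrt ((1 / T) * ∫ t in (0:ℝ)..T, (opNorm (hL t)) ^ 2)) ≤ T := by
  have hρc : Continuous ρ := continuous_pi fun i => continuous_pi fun j =>
    continuous_iff_continuousAt.2 fun t => (hd t i j).continuousAt
  have hcont : Continuous ρ' := continuous_pi fun i => continuous_pi fun j => hc i j
  have hH : ∀ t, (ρ' t).IsHermitian := fun t =>
    isHermitian_of_hasDerivAt (fun s => (hpd s).isHermitian) (hd t)
  have hF : ∀ t, HasDerivAt (fun s => maxInfo (ρ s)) (trace (ρ' t * matLog (ρ t))).re t := by
    intro t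
    have := (hasDerivAt_re_trace_mul_matLog hpd (fun s t => (htr s).trans (htr t).symm) hρc
      (hd t)).const_add (Real.log (Fintype.card n))
    simpa only [maxInfo, vnEntropy, sub_neg_eq_add] using this
  have hderiv_cont : Continuous fun t => (trace (ρ' t * matLog (ρ t))).re :=
    Complex.continuous_re.comp
      (hcont.matrix_mul (continuous_matLog_comp hρc hpd)).matrix_trace
  have hftc := intervalIntegral.integral_eq_sub_of_hasDerivAt (a := 0) (b := T)
    (fun t _ => hF t) (hderiv_cont.intervalIntegrable _ _)
  have integrable {h : ℝ → ℝ} (h0 : 0 < √((1 / T) * ∫ t in (0 : ℝ)..T, h t)) :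
      IntervalIntegrable h volume 0 T := by
    by_contra hn
    simp [intervalIntegral.integral_undef hn] at h0
  have hΛ := pos_of_mul_pos_left hpos (Real.sqrt_nonneg _)
  have hLpos := pos_of_mul_pos_right hpos (Real.sqrt_nonneg _)
  obtain ⟨hint, hcs⟩ := intervalIntegral_mul_le_sqrt_mul_sqrt hT.le
    (fun t => trNorm_nonneg (hH t)) (fun t => opNorm_nonneg (hL t))
    (integrable hΛ) (integrable hLpos)
  rw [div_le_iff₀ hpos, ← hftc]
  calc |∫ t in (0 : ℝ)..T, (trace (ρ' t * matLog (ρ t))).re|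
      ≤ ∫ t in (0 : ℝ)..T, |(trace (ρ' t * matLog (ρ t))).re| :=
        intervalIntegral.abs_integral_le_integral_abs hT.le
    _ ≤ ∫ t in (0 : ℝ)..T, trNorm (ρ' t) * opNorm (hL t) :=
        intervalIntegral.integral_mono hT.le (hderiv_cont.abs.intervalIntegrable _ _) hint
          fun t => abs_trace_mul_le (hH t) (hL t)
    _ ≤ _ := hcs
    _ = _ := by
        rw [Real.sqrt_mul (by positivity), Real.sqrt_mul (by positivity)]
        have : √(1 / T) * √(1 / T) = 1 / T := Real.mul_self_sqrt (by positivity)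
        rw [mul_mul_mul_comm, this]
        field_simp
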